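/- arXiv:1708.02622 — 2 statements merged into one kernel-verified Lean document; each statement's English description precedes it below -/
import Mathlib

section
/- Let φ : ℍ → ℍ be any map of the form φ(P) = A(P) + c, where A is a linear isometry of ℍ ≅ ℝ⁴ with determinant 1 satisfying A(1) = 1 and c ∈ ℍ. Then there exist a unit quaternion E and a quaternion T such that φ(P) = E * P * star E − 2 * E * star T for all quaternions P. (Every X₄-displacement of E⁴ arises from a dual quaternion E + εT with unit primary part.) -/
open Quaternion

namespace Quaternion

/-- The imaginary unit `i`. -/
@[simps]
def unitI : ℍ[ℝ] := ⟨0, 1, 0, 0⟩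

/-- The imaginary unit `j`. -/
@[simps]
def unitJ : ℍ[ℝ] := ⟨0, 0, 1, 0⟩

/-- The imaginary unit `k`. -/
@[simps]
def unitK : ℍ[ℝ] := ⟨0, 0, 0, 1⟩

theorem unitI_mul_unitI : unitI * unitI = -1 := by ext <;> simp

theorem unitJ_mul_unitJ : unitJ * unitJ = -1 := by ext <;> simp

theorem unitK_mul_unitK : unitK * unitK = -1 := by ext <;> simp

theorem unitI_mul_unitJ : unitI * unitJ = unitK := by ext <;> simp

theorem unitJ_mul_unitI : unitJ * unitI = -unitK := by ext <;> simp

theorem unitJ_mul_unitK : unitJ * unitK = unitI := by ext <;> simp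

theorem unitK_mul_unitJ : unitK * unitJ = -unitI := by ext <;> simp

theorem unitK_mul_unitI : unitK * unitI = unitJ := by ext <;> simp

theorem unitI_mul_unitK : unitI * unitK = -unitJ := by ext <;> simp

theorem eq_sum_units (P : ℍ[ℝ]) :
    P = P.re • (1 : ℍ[ℝ]) + P.imI • unitI + P.imJ • unitJ + P.imK • unitK := by
  ext <;> simp

/-- An algebra endomorphism of the real quaternions is intertwined with the identity
by a nonzero quaternion. -/
theorem exists_ne_zero_intertwining (f : ℍ[ℝ] →ₐ[ℝ] ℍ[ℝ]) :
    ∃ q : ℍ[ℝ], q ≠ 0 ∧ ∀ P, f P * q = q * P := by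
  -- averaging `x` over the quaternion group
  let avg (x : ℍ[ℝ]) : ℍ[ℝ] :=
    x - f unitI * x * unitI - f unitJ * x * unitJ - f unitK * x * unitK
  have push (a b x y : ℍ[ℝ]) : f a * (f b * x * y) = f (a * b) * x * y := by
    rw [map_mul]; noncomm_ring
  have intertwines (x P : ℍ[ℝ]) : f P * avg x = avg x * P := by
    have hi : f unitI * avg x = avg x * unitI := by
      simp only [avg, mul_sub, push, unitI_mul_unitI, unitI_mul_unitJ, unitI_mul_unitK,
        map_neg, map_one]
      simp only [sub_mul, mul_assoc _ _ unitI, unitI_mul_unitI, unitJ_mul_unitI, unitK_mul_unitI]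
      noncomm_ring
    have hj : f unitJ * avg x = avg x * unitJ := by
      simp only [avg, mul_sub, push, unitJ_mul_unitI, unitJ_mul_unitJ, unitJ_mul_unitK,
        map_neg, map_one]
      simp only [sub_mul, mul_assoc _ _ unitJ, unitI_mul_unitJ, unitJ_mul_unitJ, unitK_mul_unitJ]
      noncomm_ring
    have hk : f unitK * avg x = avg x * unitK := by
      simp only [avg, mul_sub, push, unitK_mul_unitI, unitK_mul_unitJ, unitK_mul_unitK,
        map_neg, map_one]
      simp only [sub_mul, mul_assoc _ _ unitK, unitI_mul_unitK, unitJ_mul_unitK, unitK_mul_unitK]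
      noncomm_ring
    rw [eq_sum_units P]
    simp only [map_add, map_smul, map_one, add_mul, mul_add, smul_mul_assoc, mul_smul_comm, hi, hj,
      hk, one_mul, mul_one]
  have total : avg 1 - avg unitI * unitI - avg unitJ * unitJ - avg unitK * unitK = (4 : ℝ) := by
    let tr (a : ℍ[ℝ]) : ℍ[ℝ] := a - unitI * a * unitI - unitJ * a * unitJ - unitK * a * unitK
    have tr_eq (a : ℍ[ℝ]) : tr a = (4 * a.re : ℝ) := by
      ext <;> simp [tr]
      ring
    have expand : avg 1 - avg unitI * unitI - avg unitJ * unitJ - avg unitK * unitK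
        = tr 1 - f unitI * tr unitI - f unitJ * tr unitJ - f unitK * tr unitK := by
      simp only [avg, tr]; noncomm_ring
    rw [expand]
    simp only [tr_eq]
    ext <;> simp
  by_contra! hq
  have avg_eq_zero (x : ℍ[ℝ]) : avg x = 0 := by
    by_contra hx
    obtain ⟨P, hP⟩ := hq _ hx
    exact hP (intertwines x P)
  have := congrArg QuaternionAlgebra.re total
  rw [re_coe] at this
  simp [avg_eq_zero] at this

/-- Every algebra endomorphism of the real quaternions is conjugation by a unit quaternion. -/
theorem exists_norm_eq_one_conj (f : ℍ[ℝ] →ₐ[ℝ] ℍ[ℝ]) :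
    ∃ E : ℍ[ℝ], ‖E‖ = 1 ∧ ∀ P, f P = E * P * star E := by
  obtain ⟨q, hq, h⟩ := exists_ne_zero_intertwining f
  have hE : ‖‖q‖⁻¹ • q‖ = 1 := norm_smul_inv_norm (𝕜 := ℝ) hq
  refine ⟨‖q‖⁻¹ • q, hE, fun P => ?_⟩
  have hstar : (‖q‖⁻¹ • q) * star (‖q‖⁻¹ • q) = 1 := by
    rw [self_mul_star, normSq_eq_norm_mul_self, hE]; simp
  rw [smul_mul_assoc, ← h, ← mul_smul_comm, mul_assoc, hstar, mul_one]

/-- If `A` fixes `1` and maps the imaginary units to imaginary quaternions, then `det A` is the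
triple product of their images. -/
theorem det_eq_inner_of_map_one (A : ℍ[ℝ] →ₗ[ℝ] ℍ[ℝ]) (h1 : A 1 = 1)
    (hi : (A unitI).re = 0) (hj : (A unitJ).re = 0) (hk : (A unitK).re = 0) :
    LinearMap.det A = inner ℝ (A unitI * A unitJ) (A unitK) := by
  let b : Module.Basis (Fin 4) ℝ ℍ[ℝ] := QuaternionAlgebra.basisOneIJK (-1) 0 (-1)
  have hrepr (q : ℍ[ℝ]) : ⇑(b.repr q) = ![q.re, q.imI, q.imJ, q.imK] := rfl
  have hb : ⇑b = ![1, unitI, unitJ, unitK] := by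
    funext n
    apply b.repr.injective
    rw [b.repr_self]
    ext m
    rw [hrepr]
    fin_cases n <;> fin_cases m <;> simp
  have hM : LinearMap.toMatrix b b A =
      !![1, 0, 0, 0;
        0, (A unitI).imI, (A unitJ).imI, (A unitK).imI;
        0, (A unitI).imJ, (A unitJ).imJ, (A unitK).imJ;
        0, (A unitI).imK, (A unitJ).imK, (A unitK).imK] := by
    ext m n
    rw [LinearMap.toMatrix_apply, hrepr, hb]
    fin_cases n <;> fin_cases m <;> simp [h1, hi, hj, hk]
  rw [← LinearMap.det_toMatrix b, hM, inner_def, Matrix.det_succ_column_zero]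
  simp [Fin.sum_univ_succ, Matrix.det_fin_three, hi, hj, hk]
  ring

theorem mul_self_eq_neg_one {u : ℍ[ℝ]} (hre : u.re = 0) (hu : ‖u‖ = 1) : u * u = -1 := by
  have h := self_mul_star u
  rw [star_eq_neg.mpr hre, normSq_eq_norm_mul_self, hu] at h
  rw [← neg_inj, ← mul_neg, h]
  simp

theorem mul_eq_neg_mul_of_inner_eq_zero {u v : ℍ[ℝ]} (hu : u.re = 0) (hv : v.re = 0)
    (h : inner ℝ u v = 0) : v * u = -(u * v) := by
  rw [inner_def] at h
  simp [hu, hv] at h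
  ext <;> simp [hu, hv] <;> linarith

/-- A linear isometry of the quaternions with determinant `1` fixing `1` is an algebra
endomorphism. -/
theorem exists_algHom_of_isometry (A : ℍ[ℝ] →ₗᵢ[ℝ] ℍ[ℝ])
    (hdet : LinearMap.det A.toLinearMap = 1) (h1 : A 1 = 1) :
    ∃ f : ℍ[ℝ] →ₐ[ℝ] ℍ[ℝ], ∀ P, f P = A P := by
  have re_map (P : ℍ[ℝ]) : (A P).re = P.re := by
    have h := A.inner_map_map P 1
    rw [h1, inner_def, inner_def] at h
    simpa using h
  have norm_unitI : ‖unitI‖ = 1 := by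
    rw [← sq_eq_sq₀ (norm_nonneg _) zero_le_one, sq, ← normSq_eq_norm_mul_self, normSq_def']; simp
  have norm_unitJ : ‖unitJ‖ = 1 := by
    rw [← sq_eq_sq₀ (norm_nonneg _) zero_le_one, sq, ← normSq_eq_norm_mul_self, normSq_def']; simp
  have norm_unitK : ‖unitK‖ = 1 := by
    rw [← unitI_mul_unitJ, norm_mul, norm_unitI, norm_unitJ, one_mul]
  have hI : (A unitI).re = 0 := by simp [re_map]
  have hJ : (A unitJ).re = 0 := by simp [re_map]
  have hK : (A unitK).re = 0 := by simp [re_map]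
  have hIJ : inner ℝ (A unitI) (A unitJ) = 0 := by
    rw [A.inner_map_map, inner_def]; simp
  have map_unitK : A unitI * A unitJ = A unitK := by
    have hn : ‖A unitI * A unitJ‖ = 1 := by
      rw [norm_mul, A.norm_map, A.norm_map, norm_unitI, norm_unitJ, one_mul]
    refine (inner_eq_one_iff_of_norm_eq_one (𝕜 := ℝ) hn ((A.norm_map _).trans norm_unitK)).mp ?_
    rw [← hdet]
    exact (det_eq_inner_of_map_one A.toLinearMap h1 hI hJ hK).symm
  let basis : QuaternionAlgebra.Basis ℍ[ℝ] (-1 : ℝ) 0 (-1) :=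
    { i := A unitI
      j := A unitJ
      k := A unitK
      i_mul_i := by
        simpa using mul_self_eq_neg_one hI ((A.norm_map _).trans norm_unitI)
      j_mul_j := by
        simpa using mul_self_eq_neg_one hJ ((A.norm_map _).trans norm_unitJ)
      i_mul_j := map_unitK
      j_mul_i := by
        rw [mul_eq_neg_mul_of_inner_eq_zero hI hJ hIJ, map_unitK, zero_smul, zero_sub] }
  refine ⟨basis.liftHom, fun P => ?_⟩
  conv_rhs => rw [eq_sum_units P]
  simp only [map_add, map_smul, h1]
  rw [← Algebra.algebraMap_eq_smul_one]
  rfl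

end Quaternion

/-- Every map `φ(P) = A(P) + c`, with `A` a linear isometry of `ℍ ≅ ℝ⁴` of
determinant `1` fixing `1`, and `c ∈ ℍ`, is of the form
`P ↦ E * P * star E - 2 * E * star T` for some unit quaternion `E` and quaternion `T`. -/
theorem stmt_1 (A : ℍ[ℝ] →ₗᵢ[ℝ] ℍ[ℝ]) (hdet : LinearMap.det A.toLinearMap = 1)
    (hA1 : A 1 = 1) (c : ℍ[ℝ]) (φ : ℍ[ℝ] → ℍ[ℝ]) (hφ : ∀ P, φ P = A P + c) :
    ∃ E T : ℍ[ℝ], ‖E‖ = 1 ∧ ∀ P : ℍ[ℝ], φ P = E * P * star E - 2 * E * star T := by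
  obtain ⟨f, hf⟩ := exists_algHom_of_isometry A hdet hA1
  obtain ⟨E, hE, hconj⟩ := exists_norm_eq_one_conj f
  refine ⟨E, -(2⁻¹ : ℝ) • (star c * E), hE, fun P => ?_⟩
  have hstar : E * star E = 1 := by
    rw [self_mul_star, normSq_eq_norm_mul_self, hE]; simp
  have hc : 2 * E * star (-(2⁻¹ : ℝ) • (star c * E)) = -c := by
    rw [Quaternion.star_smul, star_mul, star_star, mul_smul_comm, mul_assoc, ← mul_assoc E,
      hstar, one_mul, two_mul, ← two_smul ℝ c, smul_smul]
    norm_num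
  rw [hφ, ← hf, hconj, hc, sub_neg_eq_add]
end

section
/- Let E be a unit quaternion and T a quaternion, and set T' := T − (1/2)(T * star E + E * star T) * E. Then for every quaternion P, E * P * star E − 2 E * star T' = (E * P * star E − 2 E * star T) + (T * star E + E * star T), where the added term T * star E + E * star T is a real quaternion. Consequently the imaginary parts of the two images coincide: the X₄-displacement associated with the PSH-image differs from the original X₄-displacement only by a translation in the real-axis direction, so the extended inverse kinematic map κ⁻¹ is the orthogonal projection of the X₄-motion onto the hyperplane x₀ = k identified with E³. -/
open Quaternion

/-- The sum `T * star E + E * star T` is twice the real part of `T * star E`. -/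
theorem Quaternion.mul_star_add_mul_star (E T : ℍ[ℝ]) :
    T * star E + E * star T = ((2 * (T * star E).re : ℝ) : ℍ[ℝ]) := by
  simpa using Quaternion.self_add_star' (T * star E)

/-- Subtracting `(r / 2) E` from `T` translates the displacement by the real number `r`. -/
theorem Quaternion.two_mul_mul_star_sub_half_coe_mul (E T : ℍ[ℝ]) (hE : E * star E = 1) (r : ℝ) :
    2 * E * star (T - (1 / 2 : ℍ[ℝ]) * (r : ℍ[ℝ]) * E) = 2 * E * star T - (r : ℍ[ℝ]) := by
  have two_mul_half : (2 : ℍ[ℝ]) * ((r / 2 : ℝ) : ℍ[ℝ]) = (r : ℍ[ℝ]) := by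
    rw [two_mul, ← Quaternion.coe_add, add_halves]
  have : CharZero ℍ[ℝ] := charZero_of_injective_algebraMap (algebraMap ℝ ℍ[ℝ]).injective
  have half_mul : (1 / 2 : ℍ[ℝ]) * (r : ℍ[ℝ]) = ((r / 2 : ℝ) : ℍ[ℝ]) := by
    rw [one_div, inv_mul_eq_iff_eq_mul₀ two_ne_zero, two_mul_half]
  rw [half_mul, star_sub, star_mul, Quaternion.star_coe, mul_sub, ← mul_assoc (2 * E),
    mul_assoc 2 E (star E), hE, mul_one, two_mul_half]

/-- For a unit quaternion `E`, a quaternion `T` and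
`T' = T - (1/2)(T * star E + E * star T) * E`, the X₄-displacement of the PSH-image differs
from the original one only by the real translation `T * star E + E * star T`; in particular
the imaginary parts of the two images coincide (the extended inverse kinematic map `κ⁻¹` is
the orthogonal projection onto the hyperplane `x₀ = k ≅ E³`). -/
theorem stmt_11 (E T : ℍ[ℝ]) (hE : E * star E = 1) :
    ∀ P : ℍ[ℝ],
      E * P * star E - 2 * E * star (T - (1 / 2 : ℍ[ℝ]) * (T * star E + E * star T) * E) =
        (E * P * star E - 2 * E * star T) + (T * star E + E * star T) ∧
      (T * star E + E * star T).im = 0 ∧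
      (E * P * star E -
          2 * E * star (T - (1 / 2 : ℍ[ℝ]) * (T * star E + E * star T) * E)).im =
        (E * P * star E - 2 * E * star T).im := by
  intro P
  have translation :
      E * P * star E - 2 * E * star (T - (1 / 2 : ℍ[ℝ]) * (T * star E + E * star T) * E) =
        (E * P * star E - 2 * E * star T) + (T * star E + E * star T) := by
    rw [Quaternion.mul_star_add_mul_star,
      Quaternion.two_mul_mul_star_sub_half_coe_mul E T hE, sub_sub_eq_add_sub, sub_add_eq_add_sub]
  have real_sum : (T * star E + E * star T).im = 0 := by
    rw [Quaternion.mul_star_add_mul_star, Quaternion.im_coe]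
  exact ⟨translation, real_sum, by rw [translation, Quaternion.im_add, real_sum, add_zero]⟩
end
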